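/- Let (V, ι, a, b, r) be a connected finite electrical network and let x, y ∈ V be distinct vertices. Then the effective resistance satisfies R(x,y) ≥ d(x,y) / (#ι)!, where #ι is the number of edges; equivalently, C(x,y) · d(x,y) ≤ (#ι)!. -/

import Mathlib

/-- In a finite electrical network, a walk from `x` to `y` is a sequence of vertices together
with edges joining consecutive vertices (in either orientation). -/
def IsNetworkWalk {V ι : Type*} (a b : ι → V) {k : ℕ} (vs : Fin (k + 1) → V)
    (es : Fin k → ι) (x y : V) : Prop :=
  vs 0 = x ∧ vs (Fin.last k) = y ∧
    ∀ j : Fin k,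
      (a (es j) = vs j.castSucc ∧ b (es j) = vs j.succ) ∨
      (a (es j) = vs j.succ ∧ b (es j) = vs j.castSucc)

/-- The weighted shortest-path distance in the network. -/
noncomputable def networkDist {V ι : Type*} [Fintype ι] (a b : ι → V) (r : ι → ℝ)
    (x y : V) : ℝ :=
  sInf { s : ℝ | ∃ (k : ℕ) (vs : Fin (k + 1) → V) (es : Fin k → ι),
    IsNetworkWalk a b vs es x y ∧ s = ∑ j, r (es j) }

/-- The effective conductance between `x` and `y`: the infimum of the Dirichlet energy over
potentials with `f x = 0`, `f y = 1`. -/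
noncomputable def effectiveConductance {V ι : Type*} [Fintype ι] (a b : ι → V) (r : ι → ℝ)
    (x y : V) : ℝ :=
  sInf { E : ℝ | ∃ f : V → ℝ, f x = 0 ∧ f y = 1 ∧
    E = ∑ i, (f (a i) - f (b i)) ^ 2 / r i }

section Network

variable {V ι : Type*} {a b : ι → V} {r : ι → ℝ}

/-- A walk can be prolonged by an edge at its endpoint. -/
theorem IsNetworkWalk.snoc {k : ℕ} {vs : Fin (k + 1) → V} {es : Fin k → ι} {x u v : V} {i : ι}
    (h : IsNetworkWalk a b vs es x u) (hi : (a i = u ∧ b i = v) ∨ (a i = v ∧ b i = u)) :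
    IsNetworkWalk a b (Fin.snoc (α := fun _ => V) vs v) (Fin.snoc (α := fun _ => ι) es i) x v := by
  obtain ⟨h0, hl, hs⟩ := h
  refine ⟨?_, Fin.snoc_last _ _, fun j => ?_⟩
  · rw [← Fin.castSucc_zero, Fin.snoc_castSucc, h0]
  · induction j using Fin.lastCases with
    | last => simpa only [Fin.snoc_last, Fin.snoc_castSucc, Fin.succ_last, hl] using hi
    | cast j => simpa only [Fin.snoc_castSucc, Fin.succ_castSucc] using hs j

variable [Fintype ι]

theorem networkDist_le_of_walk (hr : ∀ i, 0 < r i) {k : ℕ} {vs : Fin (k + 1) → V}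
    {es : Fin k → ι} {x y : V} (h : IsNetworkWalk a b vs es x y) :
    networkDist a b r x y ≤ ∑ j, r (es j) := by
  refine csInf_le ⟨0, ?_⟩ ⟨k, vs, es, h, rfl⟩
  rintro _ ⟨_, _, _, -, rfl⟩
  exact Finset.sum_nonneg fun _ _ => (hr _).le

theorem networkDist_nonneg (hr : ∀ i, 0 < r i) (x y : V) : 0 ≤ networkDist a b r x y := by
  refine Real.sInf_nonneg ?_
  rintro _ ⟨_, _, _, -, rfl⟩
  exact Finset.sum_nonneg fun _ _ => (hr _).le

theorem networkDist_self (hr : ∀ i, 0 < r i) (x : V) : networkDist a b r x x = 0 := by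
  refine le_antisymm ?_ (networkDist_nonneg hr x x)
  have h : IsNetworkWalk a b (fun _ : Fin 1 => x) (Fin.elim0 : Fin 0 → ι) x x :=
    ⟨rfl, rfl, fun j => j.elim0⟩
  simpa using networkDist_le_of_walk hr h

theorem networkDist_le_add (hr : ∀ i, 0 < r i) {x u v : V} {i : ι}
    (hconn : ∃ (k : ℕ) (vs : Fin (k + 1) → V) (es : Fin k → ι), IsNetworkWalk a b vs es x u)
    (hi : (a i = u ∧ b i = v) ∨ (a i = v ∧ b i = u)) :
    networkDist a b r x v ≤ networkDist a b r x u + r i := by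
  rw [← sub_le_iff_le_add]
  obtain ⟨k, vs, es, h⟩ := hconn
  refine le_csInf ⟨_, k, vs, es, h, rfl⟩ ?_
  rintro _ ⟨k, vs, es, h, rfl⟩
  rw [sub_le_iff_le_add]
  simpa [Fin.sum_univ_castSucc] using networkDist_le_of_walk hr (h.snoc hi)

theorem energy_nonneg (hr : ∀ i, 0 < r i) (f : V → ℝ) :
    0 ≤ ∑ i, (f (a i) - f (b i)) ^ 2 / r i :=
  Finset.sum_nonneg fun i _ => div_nonneg (sq_nonneg _) (hr i).le

theorem effectiveConductance_le (hr : ∀ i, 0 < r i) {x y : V} {f : V → ℝ}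
    (hx : f x = 0) (hy : f y = 1) :
    effectiveConductance a b r x y ≤ ∑ i, (f (a i) - f (b i)) ^ 2 / r i := by
  refine csInf_le ⟨0, ?_⟩ ⟨f, hx, hy, rfl⟩
  rintro _ ⟨f, -, -, rfl⟩
  exact energy_nonneg hr f

/-- The potential drop along a walk is controlled by the energy. -/
theorem sq_sub_le_energy (hr : ∀ i, 0 < r i) {k : ℕ} {vs : Fin (k + 1) → V} {es : Fin k → ι}
    {x y : V} (h : IsNetworkWalk a b vs es x y) (f : V → ℝ) :
    (f y - f x) ^ 2 ≤ k * (∑ j, r (es j)) * ∑ i, (f (a i) - f (b i)) ^ 2 / r i := by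
  obtain ⟨rfl, rfl, hs⟩ := h
  set E := ∑ i, (f (a i) - f (b i)) ^ 2 / r i
  have htel : f (vs (Fin.last k)) - f (vs 0) = ∑ j : Fin k, (f (vs j.succ) - f (vs j.castSucc)) := by
    have h1 := Fin.sum_univ_succ fun j => f (vs j)
    have h2 := Fin.sum_univ_castSucc fun j => f (vs j)
    rw [Finset.sum_sub_distrib]
    linarith
  have hstep (j : Fin k) : (f (vs j.succ) - f (vs j.castSucc)) ^ 2 ≤ r (es j) * E := by
    have hE : (f (a (es j)) - f (b (es j))) ^ 2 / r (es j) ≤ E :=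
      Finset.single_le_sum (f := fun i => (f (a i) - f (b i)) ^ 2 / r i)
        (fun i _ => div_nonneg (sq_nonneg _) (hr i).le) (Finset.mem_univ (es j))
    rw [div_le_iff₀' (hr _)] at hE
    rcases hs j with ⟨ha, hb⟩ | ⟨ha, hb⟩
    · rwa [ha, hb, sub_sq_comm] at hE
    · rwa [ha, hb] at hE
  calc (f (vs (Fin.last k)) - f (vs 0)) ^ 2
      ≤ k * ∑ j : Fin k, (f (vs j.succ) - f (vs j.castSucc)) ^ 2 := by
        rw [htel]
        simpa using sq_sum_le_card_mul_sum_sq (s := Finset.univ)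
          (f := fun j : Fin k => f (vs j.succ) - f (vs j.castSucc))
    _ ≤ k * ∑ j, r (es j) * E := by gcongr with j; exact hstep j
    _ = k * (∑ j, r (es j)) * E := by rw [← Finset.sum_mul, mul_assoc]

theorem effectiveConductance_pos (hr : ∀ i, 0 < r i) {x y : V} (hxy : x ≠ y)
    (hconn : ∃ (k : ℕ) (vs : Fin (k + 1) → V) (es : Fin k → ι), IsNetworkWalk a b vs es x y) :
    0 < effectiveConductance a b r x y := by
  classical
  obtain ⟨k, vs, es, h⟩ := hconn
  have hlow (f : V → ℝ) (hx : f x = 0) (hy : f y = 1) :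
      1 ≤ k * (∑ j, r (es j)) * ∑ i, (f (a i) - f (b i)) ^ 2 / r i := by
    simpa [hx, hy] using sq_sub_le_energy hr h f
  have hx : Pi.single (M := fun _ => ℝ) y 1 x = 0 := Pi.single_eq_of_ne hxy 1
  have hy : Pi.single (M := fun _ => ℝ) y 1 y = 1 := Pi.single_eq_same y 1
  have hpos : 0 < k * ∑ j, r (es j) :=
    pos_of_mul_pos_left (one_pos.trans_le (hlow _ hx hy)) (energy_nonneg hr _)
  refine (inv_pos.2 hpos).trans_le (le_csInf ⟨_, _, hx, hy, rfl⟩ ?_)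
  rintro _ ⟨f, hfx, hfy, rfl⟩
  rw [inv_le_iff_one_le_mul₀' hpos]
  exact hlow f hfx hfy

/-- Testing the energy with the truncated distance `min (d(x,·)) (d(x,y))` bounds the effective
conductance by the number of edges over the distance. -/
theorem effectiveConductance_le_card_div_networkDist (hr : ∀ i, 0 < r i)
    (hconn : ∀ x y : V, ∃ (k : ℕ) (vs : Fin (k + 1) → V) (es : Fin k → ι),
      IsNetworkWalk a b vs es x y)
    {x y : V} (hD : 0 < networkDist a b r x y) :
    effectiveConductance a b r x y ≤ Fintype.card ι / networkDist a b r x y := by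
  set D := networkDist a b r x y with hDdef
  have hle := effectiveConductance_le (a := a) (b := b) hr (x := x) (y := y)
    (f := fun v => min (networkDist a b r x v) D / D)
    (by simp [networkDist_self hr, hD.le]) (by simp [← hDdef, hD.ne'])
  refine hle.trans ?_
  have hedge (i : ι) : (min (networkDist a b r x (a i)) D / D -
      min (networkDist a b r x (b i)) D / D) ^ 2 / r i ≤ 1 / D := by
    have hab := networkDist_le_add hr (hconn x (a i)) (Or.inl ⟨rfl, rfl⟩)
    have hba := networkDist_le_add hr (hconn x (b i)) (Or.inr ⟨rfl, rfl⟩)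
    have ha := networkDist_nonneg (a := a) (b := b) hr x (a i)
    have hb := networkDist_nonneg (a := a) (b := b) hr x (b i)
    have hri := hr i
    set p := min (networkDist a b r x (a i)) D with hp
    set q := min (networkDist a b r x (b i)) D with hq
    have hpr : |p - q| ≤ r i := by
      refine (abs_min_sub_min_le_max _ _ _ _).trans (max_le ?_ (by simpa using hri.le))
      rw [abs_le]
      constructor <;> linarith
    have hpD : |p - q| ≤ D := by
      have hp0 : 0 ≤ p := le_min ha hD.le
      have hq0 : 0 ≤ q := le_min hb hD.le
      have hp1 : p ≤ D := min_le_right _ _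
      have hq1 : q ≤ D := min_le_right _ _
      rw [abs_le]
      constructor <;> linarith
    have hsq : (p - q) ^ 2 ≤ r i * D := by
      rw [← sq_abs, sq]
      exact mul_le_mul hpr hpD (abs_nonneg _) hri.le
    rw [← sub_div, div_pow, div_div, div_le_div_iff₀ (by positivity) hD]
    nlinarith
  calc _ ≤ ∑ _i : ι, 1 / D := Finset.sum_le_sum fun i _ => hedge i
    _ = Fintype.card ι / D := by simp [div_eq_mul_inv]

end Network

/-- In a connected finite electrical network, for distinct vertices `x ≠ y`, the effective
resistance `R(x,y) = C(x,y)⁻¹` is at least `d(x,y) / (#ι)!`, where `#ι` is the number of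
edges and `d` the weighted shortest-path distance. -/
theorem effectiveResistance_ge_dist_div_factorial {V ι : Type*} [Fintype V] [Fintype ι]
    (a b : ι → V) (r : ι → ℝ) (hr : ∀ i, 0 < r i)
    (hconn : ∀ x y : V, ∃ (k : ℕ) (vs : Fin (k + 1) → V) (es : Fin k → ι),
      IsNetworkWalk a b vs es x y)
    (x y : V) (hxy : x ≠ y) :
    networkDist a b r x y / (Nat.factorial (Fintype.card ι)) ≤
      (effectiveConductance a b r x y)⁻¹ := by
  have hC := effectiveConductance_pos (a := a) (b := b) hr hxy (hconn x y)
  rcases (networkDist_nonneg (a := a) (b := b) hr x y).eq_or_lt with hD | hD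
  · rw [← hD, zero_div]
    exact (inv_pos.2 hC).le
  have hle := effectiveConductance_le_card_div_networkDist hr hconn hD
  have hfac : (Fintype.card ι : ℝ) ≤ (Nat.factorial (Fintype.card ι) : ℝ) :=
    mod_cast Nat.self_le_factorial _
  calc networkDist a b r x y / (Nat.factorial (Fintype.card ι))
      = (Nat.factorial (Fintype.card ι) / networkDist a b r x y)⁻¹ := (inv_div _ _).symm
    _ ≤ (effectiveConductance a b r x y)⁻¹ := by
        refine inv_anti₀ hC (hle.trans ?_)
        gcongr
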